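/- arXiv:0704.3693 — 2 statements merged into one kernel-verified Lean document; each statement's English description precedes it below -/
import Mathlib

section
/- For every vertex p with 0 ≤ p ≤ n and all natural numbers z₁, z₂ with z₁ + a z₂ ≡ 0 (mod r), there is a path in the labelled quiver from vertex p to vertex p with total label (z₁, z₂). (Every invariant monomial can be seen as a cycle at every vertex of the diagram of special Cohen–Macaulay modules.) -/
/-- The two-step linear recursion `s₀ = x0`, `s₁ = x1`, `s_{t+1} = α_t s_t − s_{t−1}`;
with `x0 = r, x1 = a` this is the i-series and with `x0 = 0, x1 = 1` the j-series. -/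
def ser (x0 x1 : ℤ) (α : ℕ → ℕ) : ℕ → ℤ
  | 0 => x0
  | 1 => x1
  | t + 2 => (α (t + 1) : ℤ) * ser x0 x1 α (t + 1) - ser x0 x1 α t

/-- Hirzebruch–Jung (negative) continued fraction value of a list. -/
def hj : List ℚ → ℚ
  | [] => 0
  | q :: L => q - 1 / hj L

/-- `Arrow r a n α v w ℓ` : there is an arrow `v → w` with label `ℓ = (ℓ₁, ℓ₂)` in the
labelled quiver of the diagram of special CM modules: clockwise arrows `t → t−1` with
label `(i_{t−1} − i_t, 0)` and `0 → n` with label `(1,0)`; anticlockwise arrows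
`t → t+1` with label `(0, j_{t+1} − j_t)` and `n → 0` with label `(0, r − jₙ)`; and for
`1 ≤ t ≤ n`, `1 ≤ s ≤ α_t − 2`, extra arrows `t → 0` with label
`(i_{t−1} − (s+1) i_t, s j_t − j_{t−1})`. -/
def Arrow (r a n : ℕ) (α : ℕ → ℕ) (v w : ℕ) (ℓ : ℕ × ℕ) : Prop :=
  (∃ t, 1 ≤ t ∧ t ≤ n ∧ v = t ∧ w = t - 1 ∧
    ℓ = ((ser r a α (t - 1) - ser r a α t).toNat, 0)) ∨
  (v = 0 ∧ w = n ∧ ℓ = (1, 0)) ∨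
  (∃ t, t + 1 ≤ n ∧ v = t ∧ w = t + 1 ∧
    ℓ = (0, (ser 0 1 α (t + 1) - ser 0 1 α t).toNat)) ∨
  (v = n ∧ w = 0 ∧ ℓ = (0, ((r : ℤ) - ser 0 1 α n).toNat)) ∨
  (∃ t s, 1 ≤ t ∧ t ≤ n ∧ 1 ≤ s ∧ s ≤ α t - 2 ∧ v = t ∧ w = 0 ∧
    ℓ = ((ser r a α (t - 1) - ((s : ℤ) + 1) * ser r a α t).toNat,
         ((s : ℤ) * ser 0 1 α t - ser 0 1 α (t - 1)).toNat))

/-- One step of the labelled quiver: move along an arrow, adding its label to the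
running total. -/
def StepQ (r a n : ℕ) (α : ℕ → ℕ) (x y : ℕ × ℕ × ℕ) : Prop :=
  ∃ ℓ : ℕ × ℕ, Arrow r a n α x.1 y.1 ℓ ∧ y.2.1 = x.2.1 + ℓ.1 ∧ y.2.2 = x.2.2 + ℓ.2

/-- There is a path from vertex `p` to vertex `q` with total label `(z₁, z₂)`. -/
def HasPath (r a n : ℕ) (α : ℕ → ℕ) (p q z₁ z₂ : ℕ) : Prop :=
  Relation.ReflTransGen (StepQ r a n α) (p, 0, 0) (q, z₁, z₂)

lemma ser_succ_eq_shift (x0 x1 : ℤ) (α : ℕ → ℕ) (t : ℕ) :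
    ser x0 x1 α (t + 1) = ser x1 (α 1 * x1 - x0) (fun k => α (k + 1)) t := by
  induction t using Nat.twoStepInduction with
  | zero => rfl
  | one => rfl
  | more t ih₁ ih₂ =>
    rw [ser, ih₁, ih₂]
    rfl

lemma one_lt_hj (L : List ℚ) (hne : L ≠ []) (hL : ∀ q ∈ L, 2 ≤ q) : 1 < hj L := by
  induction L with
  | nil => exact absurd rfl hne
  | cons q L ih =>
    have hq : 2 ≤ q := hL q (by simp)
    rw [hj]
    rcases eq_or_ne L [] with rfl | hL'
    · simp [hj]; linarith
    · have h := ih hL' fun x hx => hL x (by simp [hx])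
      have : 1 / hj L < 1 := by rw [div_lt_one (by linarith)]; exact h
      linarith

/-- If `x0 / x1` has the continued fraction `[α₁, …, αₙ]`, the series started at `x0, x1` is
positive and strictly decreasing until it reaches `0` at index `n + 1`. -/
lemma ser_of_hj (n : ℕ) (α : ℕ → ℕ) (x0 x1 : ℤ) (hn : 1 ≤ n) (hx1 : 0 < x1)
    (hα : ∀ t, 1 ≤ t → t ≤ n → 2 ≤ α t)
    (hval : hj ((List.range n).map fun t => (α (t + 1) : ℚ)) * x1 = x0) :
    (∀ t, t ≤ n → 0 < ser x0 x1 α t) ∧ (∀ t, t ≤ n → ser x0 x1 α (t + 1) < ser x0 x1 α t) ∧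
      ser x0 x1 α (n + 1) = 0 := by
  induction n generalizing α x0 x1 with
  | zero => omega
  | succ n ih =>
    have hx : x1 < x0 := by
      have h : 1 < hj ((List.range (n + 1)).map fun t => (α (t + 1) : ℚ)) := by
        refine one_lt_hj _ (by simp) fun q hq => ?_
        simp only [List.mem_map, List.mem_range] at hq
        obtain ⟨t, ht, rfl⟩ := hq
        exact_mod_cast hα (t + 1) (by omega) (by omega)
      have hx1' : (0 : ℚ) < x1 := by exact_mod_cast hx1
      have : (x1 : ℚ) < x0 := by rw [← hval]; nlinarith
      exact_mod_cast this
    rw [List.range_succ_eq_map, List.map_cons, List.map_map, hj] at hval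
    rcases Nat.eq_zero_or_pos n with rfl | hn'
    · simp only [List.range_zero, List.map_nil, hj, div_zero, sub_zero, zero_add] at hval
      have hv : (α 1 : ℤ) * x1 = x0 := by exact_mod_cast hval
      have h2 : ser x0 x1 α 2 = 0 := by simp [ser, hv]
      refine ⟨fun t ht => ?_, fun t ht => ?_, h2⟩
      · interval_cases t <;> simp only [ser] <;> linarith
      · interval_cases t
        · exact hx
        · exact h2.trans_lt hx1
    · set c := hj ((List.range n).map ((fun t => (α (t + 1) : ℚ)) ∘ Nat.succ)) with hc
      have hc1 : 1 < c := by
        refine one_lt_hj _ (by simp; omega) fun q hq => ?_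
        simp only [List.mem_map, List.mem_range] at hq
        obtain ⟨t, ht, rfl⟩ := hq
        change (2 : ℚ) ≤ (α (t + 1 + 1) : ℚ)
        exact_mod_cast hα (t + 1 + 1) (by omega) (by omega)
      have hx1' : (0 : ℚ) < x1 := by exact_mod_cast hx1
      have hy : ((α 1 * x1 - x0 : ℤ) : ℚ) = x1 / c := by
        push_cast
        rw [← hval]
        simp only [zero_add]
        ring
      have hy0 : 0 < (α 1 * x1 - x0 : ℤ) := by
        have : (0 : ℚ) < ((α 1 * x1 - x0 : ℤ) : ℚ) := by rw [hy]; positivity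
        exact_mod_cast this
      obtain ⟨h1, h2, h3⟩ := ih (fun k => α (k + 1)) x1 (α 1 * x1 - x0) hn' hy0
        (fun t ht ht' => hα (t + 1) (by omega) (by omega)) (by
          rw [hy]
          change c * (x1 / c) = x1
          field_simp)
      refine ⟨fun t ht => ?_, fun t ht => ?_, ?_⟩
      · cases t with
        | zero => simp only [ser]; linarith
        | succ t => rw [ser_succ_eq_shift]; exact h1 t (by omega)
      · cases t with
        | zero => exact hx
        | succ t =>
          rw [ser_succ_eq_shift, ser_succ_eq_shift x0 x1 α t]
          exact h2 t (by omega)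
      · rw [ser_succ_eq_shift]; exact h3

lemma ser_wronskian (x0 x1 : ℤ) (α : ℕ → ℕ) (t : ℕ) :
    ser x0 x1 α t * ser 0 1 α (t + 1) - ser x0 x1 α (t + 1) * ser 0 1 α t = x0 := by
  induction t with
  | zero => simp [ser]
  | succ t ih => simp only [ser] at ih ⊢; linarith

lemma dvd_ser_sub (x0 x1 : ℤ) (α : ℕ → ℕ) (t : ℕ) :
    x0 ∣ x1 * ser 0 1 α t - ser x0 x1 α t := by
  induction t using Nat.twoStepInduction with
  | zero => simp [ser]
  | one => simp [ser]
  | more t ih₁ ih₂ =>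
    have h := (ih₂.mul_left (α (t + 1))).sub ih₁
    simp only [ser]
    refine h.trans (dvd_of_eq ?_)
    ring

lemma isCoprime_ser (x0 x1 : ℤ) (h : IsCoprime x0 x1) (α : ℕ → ℕ) (t : ℕ) :
    IsCoprime (ser x0 x1 α t) (ser x0 x1 α (t + 1)) := by
  induction t with
  | zero => exact h
  | succ t ih =>
    rw [ser, sub_eq_neg_add]
    exact IsCoprime.add_mul_right_right ih.symm.neg_right _

/-- The properties of the i-series and the j-series of a continued fraction on which
the combinatorics of the quiver depends. -/
structure SeriesFacts (r a n : ℕ) (α : ℕ → ℕ) : Prop where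
  two_le : ∀ t, 1 ≤ t → t ≤ n → 2 ≤ α t
  one_le : 1 ≤ n
  i_pos : ∀ t, t ≤ n → 0 < ser r a α t
  i_lt : ∀ t, t ≤ n → ser r a α (t + 1) < ser r a α t
  i_last : ser r a α n = 1
  j_nonneg : ∀ t, t ≤ n + 1 → 0 ≤ ser 0 1 α t
  j_lt : ∀ t, t ≤ n → ser 0 1 α t < ser 0 1 α (t + 1)
  j_last : ser 0 1 α (n + 1) = r

lemma ser_zero_one_lt (n : ℕ) (α : ℕ → ℕ) (hα : ∀ t, 1 ≤ t → t ≤ n → 2 ≤ α t) (t : ℕ)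
    (ht : t ≤ n) : 0 ≤ ser 0 1 α t ∧ ser 0 1 α t < ser 0 1 α (t + 1) := by
  induction t with
  | zero => simp [ser]
  | succ t ih =>
    obtain ⟨h0, h1⟩ := ih (by omega)
    have h2 : (2 : ℤ) ≤ α (t + 1) := by exact_mod_cast hα (t + 1) (by omega) ht
    refine ⟨by linarith, ?_⟩
    rw [ser]
    nlinarith

lemma seriesFacts (r a n : ℕ) (α : ℕ → ℕ)
    (ha : 1 ≤ a) (hcop : Nat.Coprime r a) (hn : 1 ≤ n)
    (hα : ∀ t, 1 ≤ t → t ≤ n → 2 ≤ α t)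
    (hval : hj ((List.range n).map fun t => (α (t + 1) : ℚ)) = (r : ℚ) / (a : ℚ)) :
    SeriesFacts r a n α := by
  have ha' : (a : ℚ) ≠ 0 := by positivity
  obtain ⟨h1, h2, h3⟩ := ser_of_hj n α r a hn (by exact_mod_cast ha) hα (by
    rw [hval]; push_cast; field_simp)
  have hlast : ser r a α n = 1 := by
    have h := isCoprime_ser r a (Nat.isCoprime_iff_coprime.2 hcop) α n
    rw [h3, isCoprime_zero_right] at h
    rcases Int.isUnit_iff.1 h with h | h
    · exact h
    · have := h1 n le_rfl
      omega
  refine ⟨hα, hn, h1, h2, hlast, fun t ht => ?_, fun t ht => (ser_zero_one_lt n α hα t ht).2, ?_⟩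
  · cases t with
    | zero => simp [ser]
    | succ t =>
      have := ser_zero_one_lt n α hα t (by omega)
      linarith
  · have h := ser_wronskian r a α n
    rw [h3, hlast] at h
    linarith

namespace SeriesFacts

variable {r a n : ℕ} {α : ℕ → ℕ}

lemma i_strictAnti (h : SeriesFacts r a n α) {s t : ℕ} (hst : s < t) (ht : t ≤ n) :
    ser r a α t < ser r a α s := by
  induction t, hst using Nat.le_induction with
  | base => exact h.i_lt s (by omega)
  | succ t hst ih => exact (h.i_lt t (by omega)).trans (ih (by omega))

lemma j_strictMono (h : SeriesFacts r a n α) {s t : ℕ} (hst : s < t) (ht : t ≤ n) :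
    ser 0 1 α s < ser 0 1 α t := by
  induction t, hst using Nat.le_induction with
  | base => exact h.j_lt s (by omega)
  | succ t hst ih => exact (ih (by omega)).trans (h.j_lt t (by omega))

/-- An arrow `p → w` has nonzero label, of weight `i_w - i_p`. -/
lemma arrow_weight (h : SeriesFacts r a n α) {p w : ℕ} {ℓ : ℕ × ℕ} (hA : Arrow r a n α p w ℓ) :
    w ≤ n ∧ 0 < ℓ.1 + ℓ.2 ∧
      (r : ℤ) ∣ ℓ.1 + a * ℓ.2 - (ser r a α w - ser r a α p) := by
  rcases hA with ⟨t, ht, htn, rfl, rfl, rfl⟩ | ⟨rfl, rfl, rfl⟩ | ⟨t, ht, rfl, rfl, rfl⟩ |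
    ⟨rfl, rfl, rfl⟩ | ⟨t, s, ht, htn, hs, hs', rfl, rfl, rfl⟩
  · obtain ⟨u, rfl⟩ := Nat.exists_eq_add_of_le' ht
    have := h.i_lt u (by omega)
    simp only [Nat.add_sub_cancel]
    refine ⟨by omega, by omega, ?_⟩
    rw [Int.toNat_of_nonneg (by omega)]
    simp
  · refine ⟨le_rfl, by simp, ?_⟩
    rw [h.i_last]
    simp [ser]
  · have := h.j_lt p (by omega)
    refine ⟨ht, by simp; omega, ?_⟩
    rw [Int.toNat_of_nonneg (by omega)]
    refine Dvd.dvd.trans ((dvd_ser_sub r a α (p + 1)).sub (dvd_ser_sub r a α p)) (dvd_of_eq ?_)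
    push_cast
    ring
  · have := h.j_lt p le_rfl
    rw [h.j_last] at this
    refine ⟨by omega, by simp; omega, ?_⟩
    rw [Int.toNat_of_nonneg (by omega)]
    have h0 : (r : ℤ) ∣ (a - 1) * r := Dvd.intro_left _ rfl
    refine Dvd.dvd.trans (h0.sub (dvd_ser_sub r a α p)) (dvd_of_eq ?_)
    simp only [ser]
    push_cast
    ring
  · obtain ⟨u, rfl⟩ := Nat.exists_eq_add_of_le' ht
    have hj := h.j_lt u (by omega)
    have hj0 := h.j_nonneg u (by omega)
    have hi := h.i_pos (u + 1) htn
    have hi' := h.i_lt (u + 1) htn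
    have hs1 : (1 : ℤ) ≤ s := by exact_mod_cast hs
    have hs2 : (s : ℤ) + 2 ≤ α (u + 1) := by
      have := h.two_le (u + 1) ht htn
      omega
    simp only [Nat.add_sub_cancel]
    have hx : 0 ≤ ser r a α u - ((s : ℤ) + 1) * ser r a α (u + 1) := by
      rw [ser] at hi'
      nlinarith
    have hy : 0 < (s : ℤ) * ser 0 1 α (u + 1) - ser 0 1 α u := by nlinarith
    refine ⟨by omega, by omega, ?_⟩
    rw [Int.toNat_of_nonneg hx, Int.toNat_of_nonneg hy.le]
    have h0 : (r : ℤ) ∣ -r := by simp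
    refine Dvd.dvd.trans ((((dvd_ser_sub r a α (u + 1)).mul_left s).sub
      (dvd_ser_sub r a α u)).add h0) (dvd_of_eq ?_)
    simp only [ser]
    ring

end SeriesFacts

/-- The lattice of points of weight `0` has the basis `(i, -j)`, `(A, B)`. -/
lemma exists_lattice_coords {r a i j A B w₁ w₂ : ℤ} (hr : 0 < r) (hdet : i * B + j * A = r)
    (hij : r ∣ a * j - i) (hAB : r ∣ A + a * B) (hw : r ∣ w₁ + a * w₂) :
    ∃ m k : ℤ, w₁ = m * i + k * A ∧ w₂ = k * B - m * j := by
  obtain ⟨m, hm⟩ : r ∣ w₁ * B - w₂ * A := by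
    refine Dvd.dvd.trans ((hw.mul_left B).sub (hAB.mul_left w₂)) (dvd_of_eq ?_)
    ring
  obtain ⟨k, hk⟩ : r ∣ w₁ * j + w₂ * i := by
    refine Dvd.dvd.trans ((hw.mul_left j).sub (hij.mul_left w₂)) (dvd_of_eq ?_)
    ring
  refine ⟨m, k, ?_, ?_⟩ <;> apply mul_left_cancel₀ hr.ne'
  · linear_combination i * hm + A * hk - w₁ * hdet
  · linear_combination B * hk - j * hm - w₂ * hdet

/-- The only point of `[0, A) × [0, B)` of weight `i_q - i`, where `(i_q, j_q)` lies in the same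
weight class in both coordinates, is the origin. -/
lemma eq_zero_of_lt_box {r a i j A B iq jq z₁ z₂ : ℤ} (hr : 0 < r) (hdet : i * B + j * A = r)
    (hij : r ∣ a * j - i) (hAB : r ∣ A + a * B) (hq : r ∣ a * jq - iq)
    (hi : 0 < i) (hj : 0 < j) (hiq : 0 < iq) (hjq : 0 ≤ jq) (horder : iq ≤ i ∨ jq < j)
    (hz₁ : 0 ≤ z₁) (hz₂ : 0 ≤ z₂) (hzA : z₁ < A) (hzB : z₂ < B)
    (hz : r ∣ z₁ + a * z₂ - (iq - i)) : z₁ = 0 ∧ z₂ = 0 := by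
  rcases horder with ho | ho
  · obtain ⟨m, k, h1, h2⟩ := exists_lattice_coords (w₁ := z₁ + i - iq) (w₂ := z₂) hr hdet hij hAB
      (hz.trans (dvd_of_eq (by ring)))
    rcases le_or_gt m 0 with hm | hm
    · have hk : k ≤ 0 := by
        by_contra! hk
        nlinarith [mul_nonneg (neg_nonneg.2 hm) hj.le]
      have hkA : k * A ≤ 0 := mul_nonpos_of_nonpos_of_nonneg hk (by linarith)
      have hmi : m * i ≤ 0 := mul_nonpos_of_nonpos_of_nonneg hm hi.le
      have hm0 : m * i = 0 := by linarith
      have hkB : k * B ≤ 0 := mul_nonpos_of_nonpos_of_nonneg hk (by linarith)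
      have : m = 0 := by simpa [hi.ne'] using hm0
      subst this
      constructor <;> linarith
    · have hk : 0 < k := by
        by_contra! hk
        nlinarith [mul_pos hm hj, mul_nonneg (neg_nonneg.2 hk) (hz₂.trans hzB.le)]
      nlinarith
  · obtain ⟨m, k, h1, h2⟩ := exists_lattice_coords (w₁ := z₁ + i) (w₂ := z₂ - jq) hr hdet hij hAB
      ((hz.sub hq).trans (dvd_of_eq (by ring)))
    exfalso
    rcases le_or_gt m 0 with hm | hm
    · have hmj : m * j ≤ 0 := mul_nonpos_of_nonpos_of_nonneg hm hj.le
      have hmi : m * i ≤ 0 := mul_nonpos_of_nonpos_of_nonneg hm hi.le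
      rcases le_or_gt k 0 with hk | hk
      · have hkA : k * A ≤ 0 := mul_nonpos_of_nonpos_of_nonneg hk (by linarith)
        linarith
      · have : B ≤ k * B := le_mul_of_one_le_left (by linarith) hk
        linarith
    · have hmj : j ≤ m * j := le_mul_of_one_le_left hj.le hm
      have hmi : i ≤ m * i := le_mul_of_one_le_left hi.le hm
      rcases le_or_gt k 0 with hk | hk
      · have hkB : k * B ≤ 0 := mul_nonpos_of_nonpos_of_nonneg hk (by linarith)
        linarith
      · have : A ≤ k * A := le_mul_of_one_le_left (by linarith) hk
        linarith

namespace SeriesFacts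

variable {r a n : ℕ} {α : ℕ → ℕ}

/-- Every nontrivial monomial of weight `i_q - i_p` is divisible by the label of an arrow
leaving `p`. -/
lemma exists_arrow_le (h : SeriesFacts r a n α) {p q z₁ z₂ : ℕ} (hp : p ≤ n) (hq : q ≤ n)
    (hz : (r : ℤ) ∣ z₁ + a * z₂ - (ser r a α q - ser r a α p)) (hne : 0 < z₁ + z₂) :
    ∃ w ℓ, Arrow r a n α p w ℓ ∧ ℓ.1 ≤ z₁ ∧ ℓ.2 ≤ z₂ := by
  rcases Nat.eq_zero_or_pos p with rfl | hp0
  · rcases Nat.eq_zero_or_pos z₁ with rfl | hz₁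
    · refine ⟨1, _, Or.inr (Or.inr (Or.inl ⟨0, h.one_le, rfl, rfl, rfl⟩)), by simp, ?_⟩
      simp [ser]
      omega
    · exact ⟨n, _, Or.inr (Or.inl ⟨rfl, rfl, rfl⟩), hz₁, by simp⟩
  obtain ⟨u, rfl⟩ : ∃ u, p = u + 1 := ⟨p - 1, by omega⟩
  by_contra! hcon
  have hr : (0 : ℤ) < r := h.i_pos 0 (by omega)
  have hi := h.i_pos (u + 1) hp
  have hj' := h.j_nonneg u (by omega)
  have hj : 0 < ser 0 1 α (u + 1) := hj'.trans_lt (h.j_lt u (by omega))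
  have hclock : (z₁ : ℤ) < ser r a α u - ser r a α (u + 1) := by
    by_contra! hle
    have := hcon u _ (Or.inl ⟨u + 1, hp0, hp, rfl, rfl, rfl⟩) (by simpa using hle)
    simp at this
  have hanti : (z₂ : ℤ) < ser 0 1 α (u + 1 + 1) - ser 0 1 α (u + 1) := by
    by_contra! hle
    rcases hp.lt_or_eq with hlt | heq
    · have := hcon (u + 1 + 1) _ (Or.inr (Or.inr (Or.inl ⟨u + 1, hlt, rfl, rfl, rfl⟩))) (by simp)
      simp only at this
      omega
    · have := hcon 0 _ (Or.inr (Or.inr (Or.inr (Or.inl ⟨heq, rfl, rfl⟩)))) (by simp)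
      have hl := h.j_last
      rw [← heq] at hl this
      simp only at this
      omega
  obtain ⟨s, hs₁, hs₂⟩ : ∃ s : ℕ, (s : ℤ) * ser 0 1 α (u + 1) ≤ z₂ + ser 0 1 α u ∧
      (z₂ : ℤ) + ser 0 1 α u < (s + 1) * ser 0 1 α (u + 1) := by
    refine ⟨((z₂ + ser 0 1 α u) / ser 0 1 α (u + 1)).toNat, ?_, ?_⟩ <;>
      rw [Int.toNat_of_nonneg (Int.ediv_nonneg (by omega) hj.le)]
    · exact Int.ediv_mul_le _ hj.ne'
    · exact Int.lt_ediv_add_one_mul_self _ hj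
  have hsα : s + 2 ≤ α (u + 1) := by
    rw [ser] at hanti
    have : (s : ℤ) < α (u + 1) - 1 := by
      refine lt_of_mul_lt_mul_right ?_ hj.le
      linarith
    omega
  have hA : (z₁ : ℤ) < ser r a α u - ((s : ℤ) + 1) * ser r a α (u + 1) := by
    rcases Nat.eq_zero_or_pos s with rfl | hs0
    · simpa using hclock
    · by_contra! hle
      have := hcon 0 _ (Or.inr (Or.inr (Or.inr (Or.inr
        ⟨u + 1, s, hp0, hp, hs0, by omega, rfl, rfl, rfl⟩)))) (by simpa using hle)
      simp only [Nat.add_sub_cancel] at this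
      omega
  have hB : (z₂ : ℤ) < ((s : ℤ) + 1) * ser 0 1 α (u + 1) - ser 0 1 α u := by linarith
  have hw := ser_wronskian r a α u
  have hbox := eq_zero_of_lt_box (a := a) (jq := ser 0 1 α q) hr
    (by linear_combination hw) (dvd_ser_sub r a α (u + 1))
    (by
      refine Dvd.dvd.trans (((dvd_ser_sub r a α (u + 1)).mul_left ((s : ℤ) + 1)).sub
        (dvd_ser_sub r a α u)) (dvd_of_eq ?_)
      ring)
    (dvd_ser_sub r a α q) hi hj (h.i_pos q hq) (h.j_nonneg q (by omega))
    (by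
      rcases lt_trichotomy q (u + 1) with hlt | rfl | hlt
      · exact Or.inr (h.j_strictMono hlt hp)
      · exact Or.inl le_rfl
      · exact Or.inl (h.i_strictAnti hlt hq).le)
    (Int.natCast_nonneg z₁) (Int.natCast_nonneg z₂) hA hB hz
  omega

lemma i_le (h : SeriesFacts r a n α) {t : ℕ} (ht : t ≤ n) : ser r a α t ≤ r := by
  rcases Nat.eq_zero_or_pos t with rfl | h0
  · exact le_rfl
  · exact (h.i_strictAnti h0 ht).le

lemma eq_of_dvd (h : SeriesFacts r a n α) {p q : ℕ} (hp : p ≤ n) (hq : q ≤ n)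
    (hd : (r : ℤ) ∣ ser r a α q - ser r a α p) : p = q := by
  have hp1 := h.i_pos p hp
  have hq1 := h.i_pos q hq
  have hp2 := h.i_le hp
  have hq2 := h.i_le hq
  have h0 := Int.eq_zero_of_abs_lt_dvd hd (abs_lt.2 ⟨by omega, by omega⟩)
  rcases lt_trichotomy p q with hlt | rfl | hlt
  · have := h.i_strictAnti hlt hq
    omega
  · rfl
  · have := h.i_strictAnti hlt hp
    omega

end SeriesFacts

lemma StepQ.translate {r a n : ℕ} {α : ℕ → ℕ} (c d : ℕ) {x y : ℕ × ℕ × ℕ}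
    (h : StepQ r a n α x y) :
    StepQ r a n α (x.1, c + x.2.1, d + x.2.2) (y.1, c + y.2.1, d + y.2.2) := by
  obtain ⟨ℓ, hA, h1, h2⟩ := h
  exact ⟨ℓ, hA, by simp only [h1, add_assoc], by simp only [h2, add_assoc]⟩

lemma HasPath.cons {r a n : ℕ} {α : ℕ → ℕ} {p w q z₁ z₂ : ℕ} {ℓ : ℕ × ℕ}
    (hA : Arrow r a n α p w ℓ) (h : HasPath r a n α w q z₁ z₂) :
    HasPath r a n α p q (ℓ.1 + z₁) (ℓ.2 + z₂) :=
  Relation.ReflTransGen.head (b := (w, ℓ.1, ℓ.2)) ⟨ℓ, hA, by simp, by simp⟩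
    (Relation.ReflTransGen.lift (fun x : ℕ × ℕ × ℕ => (x.1, ℓ.1 + x.2.1, ℓ.2 + x.2.2))
      (fun _ _ hs => hs.translate ℓ.1 ℓ.2) _ _ h)

/-- Every monomial of weight `i_q - i_p` is the label of a path from `p` to `q`. -/
lemma SeriesFacts.hasPath {r a n : ℕ} {α : ℕ → ℕ} (h : SeriesFacts r a n α) {p q z₁ z₂ : ℕ}
    (hp : p ≤ n) (hq : q ≤ n)
    (hz : (r : ℤ) ∣ z₁ + a * z₂ - (ser r a α q - ser r a α p)) :
    HasPath r a n α p q z₁ z₂ := by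
  induction hN : z₁ + z₂ using Nat.strong_induction_on generalizing p z₁ z₂ with
  | _ N ih =>
    rcases Nat.eq_zero_or_pos (z₁ + z₂) with h0 | h0
    · obtain ⟨rfl, rfl⟩ : z₁ = 0 ∧ z₂ = 0 := by omega
      obtain rfl := h.eq_of_dvd hp hq ((dvd_neg.2 hz).trans (by simp))
      exact Relation.ReflTransGen.refl
    · obtain ⟨w, ℓ, hA, h1, h2⟩ := h.exists_arrow_le hp hq hz h0
      obtain ⟨hw, hpos, hwt⟩ := h.arrow_weight hA
      obtain ⟨y₁, rfl⟩ := Nat.exists_eq_add_of_le h1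
      obtain ⟨y₂, rfl⟩ := Nat.exists_eq_add_of_le h2
      refine HasPath.cons hA (ih (y₁ + y₂) (by omega) hw ?_ rfl)
      refine (hz.sub hwt).trans (dvd_of_eq ?_)
      push_cast
      ring

/-- every invariant monomial can be seen as a cycle at every vertex of the
diagram of special Cohen-Macaulay modules. -/
theorem stmt_6 (r a n : ℕ) (α : ℕ → ℕ)
    (ha : 1 ≤ a) (har : a < r) (hcop : Nat.Coprime r a) (hn : 1 ≤ n)
    (hα : ∀ t, 1 ≤ t → t ≤ n → 2 ≤ α t)
    (hval : hj ((List.range n).map fun t => (α (t + 1) : ℚ)) = (r : ℚ) / (a : ℚ)) :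
    ∀ p, p ≤ n → ∀ z₁ z₂ : ℕ,
      ((z₁ : ℤ) + (a : ℤ) * (z₂ : ℤ)) ≡ 0 [ZMOD (r : ℤ)] →
      HasPath r a n α p p z₁ z₂ := by
  intro p hp z₁ z₂ hz
  refine (seriesFacts r a n α ha hcop hn hα hval).hasPath hp hp ?_
  simpa using Int.modEq_zero_iff_dvd.1 hz
end

section
/- For every 0 ≤ p ≤ n and all natural numbers z₁, z₂ with z₁ + a z₂ ≡ i_p (mod r), there is a path in the labelled quiver from vertex 0 to vertex p with total label (z₁, z₂). (Every map S₀ → S_{i_p} can be seen in the diagram of special Cohen–Macaulay modules.) -/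
theorem ser_shift (x0 x1 : ℤ) (α : ℕ → ℕ) (t : ℕ) :
    ser x0 x1 α (t + 1) = ser x1 ((α 1 : ℤ) * x1 - x0) (fun k => α (k + 1)) t := by
  induction t using Nat.twoStepInduction with
  | zero => rfl
  | one => rfl
  | more t ih₁ ih₂ =>
    rw [ser, ih₁, ih₂]
    rfl

theorem one_lt_hj_s7 (α : ℕ → ℕ) (n : ℕ) (hn : 1 ≤ n) (hα : ∀ t, 1 ≤ t → t ≤ n → 2 ≤ α t) :
    1 < hj ((List.range n).map fun t => (α (t + 1) : ℚ)) := by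
  induction n, hn using Nat.le_induction generalizing α with
  | base =>
    have h : (2 : ℚ) ≤ α 1 := by exact_mod_cast hα 1 le_rfl le_rfl
    simp only [List.range_one, List.map_cons, List.map_nil, hj, div_zero, sub_zero, zero_add]
    linarith
  | succ n hn ih =>
    have h : (2 : ℚ) ≤ α 1 := by exact_mod_cast hα 1 le_rfl (by omega)
    have h' := ih (fun k => α (k + 1)) (fun t _ _ => hα (t + 1) (by omega) (by omega))
    rw [List.range_succ_eq_map, List.map_cons, List.map_map, hj]
    have h'' := (div_lt_one (by linarith)).2 h'
    simp only [zero_add]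
    change 1 < (α 1 : ℚ) - 1 / hj ((List.range n).map fun t => (α (t + 1 + 1) : ℚ))
    linarith

/-- A sequence whose initial ratio is given by the continued fraction strictly decreases to `0`. -/
theorem ser_decreasing (α : ℕ → ℕ) (n : ℕ) (hn : 1 ≤ n)
    (hα : ∀ t, 1 ≤ t → t ≤ n → 2 ≤ α t) (x0 x1 : ℤ) (hx : 0 < x1)
    (hval : (x0 : ℚ) = x1 * hj ((List.range n).map fun t => (α (t + 1) : ℚ))) :
    (∀ t, t ≤ n → ser x0 x1 α (t + 1) < ser x0 x1 α t) ∧ ser x0 x1 α (n + 1) = 0 := by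
  have hxq : (0 : ℚ) < x1 := by exact_mod_cast hx
  have hlt : x1 < x0 := by
    have := mul_lt_mul_of_pos_left (one_lt_hj_s7 α n hn hα) hxq
    rw [← hval, mul_one] at this
    exact_mod_cast this
  induction n, hn using Nat.le_induction generalizing α x0 x1 with
  | base =>
    simp only [List.range_one, List.map_cons, List.map_nil, hj, div_zero, sub_zero,
      zero_add] at hval
    have h0 : x0 = x1 * α 1 := by exact_mod_cast hval
    have h2 : ser x0 x1 α 2 = 0 := by
      simp only [ser]
      rw [h0]
      ring
    refine ⟨fun t ht => ?_, h2⟩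
    interval_cases t
    · exact hlt
    · exact h2.trans_lt hx
  | succ n hn ih =>
    have hα' : ∀ t, 1 ≤ t → t ≤ n → 2 ≤ α (t + 1) :=
      fun t _ _ => hα (t + 1) (by omega) (by omega)
    have h' := one_lt_hj_s7 (fun k => α (k + 1)) n hn hα'
    rw [List.range_succ_eq_map, List.map_cons, List.map_map, hj] at hval
    change (x0 : ℚ) = x1 * ((α 1 : ℚ) -
      1 / hj ((List.range n).map fun t => (α (t + 1 + 1) : ℚ))) at hval
    set H := hj ((List.range n).map fun t => (α (t + 1 + 1) : ℚ))
    have hH : (0 : ℚ) < H := by linarith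
    have hx2 : ((α 1 : ℚ) * x1 - x0) = x1 / H := by rw [hval]; ring
    have hx2pos : 0 < (α 1 : ℤ) * x1 - x0 := by
      have : (0 : ℚ) < (α 1 : ℚ) * x1 - x0 := hx2 ▸ div_pos hxq hH
      exact_mod_cast this
    have hx2lt : (α 1 : ℤ) * x1 - x0 < x1 := by
      have : (α 1 : ℚ) * x1 - x0 < x1 := hx2 ▸ div_lt_self hxq h'
      exact_mod_cast this
    have hval' : (x1 : ℚ) = (((α 1 : ℤ) * x1 - x0 : ℤ) : ℚ) * H := by
      push_cast
      rw [hx2]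
      field_simp
    obtain ⟨hd, h0⟩ := ih (fun k => α (k + 1)) hα' x1 _ hx2pos hval'
      (by exact_mod_cast hx2pos) hx2lt
    refine ⟨fun t ht => ?_, by rw [ser_shift, h0]⟩
    cases t with
    | zero => exact hlt
    | succ t =>
      rw [ser_shift, ser_shift x0 x1 α t]
      exact hd t (by omega)

theorem ser_det (r a : ℤ) (α : ℕ → ℕ) (t : ℕ) :
    ser r a α t * ser 0 1 α (t + 1) - ser r a α (t + 1) * ser 0 1 α t = r := by
  induction t with
  | zero => simp [ser]
  | succ t ih => linear_combination (norm := (simp only [ser]; ring)) ih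

theorem ser_dvd (r a : ℤ) (α : ℕ → ℕ) (t : ℕ) :
    r ∣ ser r a α t - a * ser 0 1 α t := by
  induction t using Nat.twoStepInduction with
  | zero => simp [ser]
  | one => simp [ser]
  | more t ih₁ ih₂ =>
    have : ser r a α (t + 2) - a * ser 0 1 α (t + 2)
        = α (t + 1) * (ser r a α (t + 1) - a * ser 0 1 α (t + 1))
          - (ser r a α t - a * ser 0 1 α t) := by
      simp only [ser]; ring
    rw [this]
    exact dvd_sub (ih₂.mul_left _) ih₁

theorem ser_isCoprime (r a : ℤ) (α : ℕ → ℕ) (h : IsCoprime r a) (t : ℕ) :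
    IsCoprime (ser r a α t) (ser r a α (t + 1)) := by
  induction t with
  | zero => exact h
  | succ t ih =>
    obtain ⟨u, v, huv⟩ := ih
    refine ⟨v + u * α (t + 1), -u, ?_⟩
    rw [← huv]
    simp only [ser]
    ring

theorem ser_zero_one_increasing (α : ℕ → ℕ) (n : ℕ) (hα : ∀ t, 1 ≤ t → t ≤ n → 2 ≤ α t)
    (t : ℕ) (ht : t ≤ n) :
    0 ≤ ser 0 1 α t ∧ ser 0 1 α t < ser 0 1 α (t + 1) := by
  induction t with
  | zero => simp [ser]
  | succ t ih =>
    obtain ⟨h0, h1⟩ := ih (by omega)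
    have h2 : (2 : ℤ) ≤ α (t + 1) := by exact_mod_cast hα (t + 1) (by omega) ht
    refine ⟨by omega, ?_⟩
    rw [show ser 0 1 α (t + 1 + 1) = α (t + 1) * ser 0 1 α (t + 1) - ser 0 1 α t from rfl]
    nlinarith

/-- Coordinates of a point of the invariant lattice in the basis `(i₀, -j₀), (i₁, -j₁)`. -/
theorem exists_lattice_coords_s7 {r a i₀ i₁ j₀ j₁ x y : ℤ} (hr : r ≠ 0)
    (hdet : i₀ * j₁ - i₁ * j₀ = r) (h₀ : r ∣ i₀ - a * j₀) (h₁ : r ∣ i₁ - a * j₁)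
    (h : r ∣ x + a * y) :
    ∃ A B : ℤ, x = A * i₀ + B * i₁ ∧ y = -(A * j₀) - B * j₁ := by
  have hA : r ∣ x * j₁ + y * i₁ := by
    have := dvd_add (h.mul_right j₁) (h₁.mul_right y)
    exact this.trans (dvd_of_eq (by ring))
  have hB : r ∣ x * j₀ + y * i₀ := by
    have := dvd_add (h.mul_right j₀) (h₀.mul_right y)
    exact this.trans (dvd_of_eq (by ring))
  obtain ⟨A, hA⟩ := hA
  obtain ⟨B, hB⟩ := hB
  refine ⟨A, -B, mul_left_cancel₀ hr ?_, mul_left_cancel₀ hr ?_⟩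
  · linear_combination i₀ * hA - i₁ * hB - x * hdet
  · linear_combination -j₀ * hA + j₁ * hB - y * hdet

theorem eq_zero_of_cone {i₀ i₁ j₀ j₁ A B : ℤ} (hi₁ : 0 < i₁) (hi : i₁ < i₀) (hj : j₀ < j₁)
    (hj₀ : 0 ≤ j₀) (hA : A ≤ 0) (hI : 0 ≤ A * i₀ + B * i₁) (hJ : A * j₀ + B * j₁ ≤ 0) :
    A = 0 ∧ B = 0 := by
  have h1 : 0 ≤ A + B := by
    by_contra! h
    nlinarith
  have h2 : A + B ≤ 0 := by
    by_contra! h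
    nlinarith
  have hB : B = -A := by omega
  subst hB
  have : A = 0 := by
    by_contra h
    have : A < 0 := by omega
    nlinarith
  simp [this]

/-- The boxes below the staircase of extra arrows contain no nonzero invariant monomial. -/
theorem box_invariant_eq_zero {r a i₀ i₁ j₀ j₁ x y : ℤ} (hr : r ≠ 0)
    (hdet : i₀ * j₁ - i₁ * j₀ = r) (h₀ : r ∣ i₀ - a * j₀) (h₁ : r ∣ i₁ - a * j₁)
    (hi₁ : 0 < i₁) (hi : i₁ < i₀) (hj : j₀ < j₁) (hj₀ : 0 ≤ j₀)
    (h : r ∣ x + a * y) (hx : 0 ≤ x) (hy : 0 ≤ y) (m : ℤ)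
    (hxm : x < i₀ - m * i₁) (hym : y < m * j₁ - j₀) : x = 0 ∧ y = 0 := by
  obtain ⟨A, B, rfl, rfl⟩ := exists_lattice_coords_s7 hr hdet h₀ h₁ h
  rcases le_or_gt A 0 with hA | hA
  · obtain ⟨rfl, rfl⟩ := eq_zero_of_cone hi₁ hi hj hj₀ hA hx (by linarith)
    simp
  · obtain ⟨hA', hB'⟩ := eq_zero_of_cone (A := 1 - A) (B := -(B + m)) hi₁ hi hj hj₀
      (by omega) (by linarith) (by linarith)
    have hA1 : A = 1 := by omega
    have hB1 : B = -m := by omega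
    subst hA1 hB1
    linarith

/-- The module of monomials of weight `i₁` is generated by `x ^ i₁` and `y ^ j₁`. -/
theorem le_or_le_of_weight {r a i₀ i₁ j₀ j₁ x y : ℤ} (hr : r ≠ 0)
    (hdet : i₀ * j₁ - i₁ * j₀ = r) (h₀ : r ∣ i₀ - a * j₀) (h₁ : r ∣ i₁ - a * j₁)
    (hi₁ : 0 < i₁) (hi : i₁ < i₀) (hj : j₀ < j₁) (hj₀ : 0 ≤ j₀)
    (h : r ∣ x + a * y - i₁) (hx : 0 ≤ x) (hy : 0 ≤ y) : i₁ ≤ x ∨ j₁ ≤ y := by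
  by_contra! hlt
  obtain ⟨hx', hy'⟩ := hlt
  obtain ⟨A, B, hA, rfl⟩ := exists_lattice_coords_s7 (x := x - i₁) (y := y) hr hdet h₀ h₁
    (h.trans (dvd_of_eq (by ring)))
  rcases lt_or_ge A 0 with hneg | hpos
  · have h1 : 0 ≤ A + B := by
      by_contra! h
      nlinarith
    nlinarith
  · have h1 : B < -A := by
      by_contra! h
      nlinarith
    nlinarith

theorem HasPath.snoc {r a n : ℕ} {α : ℕ → ℕ} {v q z₁ z₂ : ℕ} {ℓ : ℕ × ℕ}
    (harr : Arrow r a n α v q ℓ) (h₁ : ℓ.1 ≤ z₁) (h₂ : ℓ.2 ≤ z₂)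
    (h : HasPath r a n α 0 v (z₁ - ℓ.1) (z₂ - ℓ.2)) : HasPath r a n α 0 q z₁ z₂ :=
  Relation.ReflTransGen.tail h
    ⟨ℓ, harr, (Nat.sub_add_cancel h₁).symm, (Nat.sub_add_cancel h₂).symm⟩

/-- Every nonzero invariant monomial is divisible by the label of some arrow into `0`. -/
theorem exists_arrow_to_zero (r a n : ℕ) (α : ℕ → ℕ) (hn : 1 ≤ n) (hr : (r : ℤ) ≠ 0)
    (hα : ∀ t, 1 ≤ t → t ≤ n → 2 ≤ α t)
    (hi : ∀ t, t ≤ n → ser r a α (t + 1) < ser r a α t)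
    (hipos : ∀ t, t ≤ n → 0 < ser r a α t)
    (hjn : ser 0 1 α (n + 1) = r) (z₁ z₂ : ℕ) (hz : z₁ ≠ 0 ∨ z₂ ≠ 0)
    (h : (r : ℤ) ∣ z₁ + a * z₂) :
    ∃ t, 1 ≤ t ∧ t ≤ n ∧ ∃ u v : ℤ, 0 ≤ u ∧ 0 ≤ v ∧ 0 < u + v ∧ u ≤ z₁ ∧ v ≤ z₂ ∧
      (r : ℤ) ∣ u + a * v + ser r a α t ∧ Arrow r a n α t 0 (u.toNat, v.toNat) := by
  have hj := ser_zero_one_increasing α n hα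
  have hdvd := ser_dvd r a α
  by_contra! hno
  have box : ∀ t, t + 1 ≤ n → ∀ m : ℤ, (z₁ : ℤ) < ser r a α t - m * ser r a α (t + 1) →
      m * ser 0 1 α (t + 1) - ser 0 1 α t ≤ z₂ := by
    intro t ht m hx
    by_contra! hy
    have := box_invariant_eq_zero hr (ser_det r a α t) (hdvd t) (hdvd (t + 1))
      (hipos _ ht) (hi t (by omega)) (hj t (by omega)).2 (hj t (by omega)).1 h
      (by positivity) (by positivity) m hx hy
    omega
  have hstep : ∀ t, t + 1 ≤ n → ∀ m : ℕ, 1 ≤ m → m ≤ α (t + 1) - 1 →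
      (z₁ : ℤ) < ser r a α t - ser r a α (t + 1) →
      (z₁ : ℤ) < ser r a α t - m * ser r a α (t + 1) := by
    intro t ht m hm
    induction m, hm using Nat.le_induction with
    | base => intro _ hx; simpa using hx
    | succ s hs ih =>
      intro hsα hx
      by_contra! hu
      have hv := box t ht s (ih (by omega) hx)
      have hjt := hj t (by omega)
      have hit := hi (t + 1) ht
      have hs1 : (1 : ℤ) ≤ s := by exact_mod_cast hs
      have hs2 : (s : ℤ) + 2 ≤ α (t + 1) := by exact_mod_cast (by omega)
      have hrec : ser r a α (t + 1 + 1) = α (t + 1) * ser r a α (t + 1) - ser r a α t := rfl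
      have hi1 := hipos (t + 1) ht
      have hupos : 0 < ser r a α t - ((s : ℤ) + 1) * ser r a α (t + 1) := by nlinarith
      have hvpos : 0 ≤ (s : ℤ) * ser 0 1 α (t + 1) - ser 0 1 α t := by nlinarith
      refine hno (t + 1) (by omega) ht _ _ hupos.le hvpos (by linarith)
        (by push_cast at hu; exact hu) hv ?_
        (Or.inr <| Or.inr <| Or.inr <| Or.inr
          ⟨t + 1, s, by omega, ht, hs, by omega, rfl, rfl, rfl⟩)
      have := dvd_sub (hdvd t) ((hdvd (t + 1)).mul_left s)
      exact this.trans (dvd_of_eq (by ring))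
  have hcorner : ∀ t, t ≤ n → (z₁ : ℤ) < ser r a α t - ser r a α (t + 1) := by
    intro t
    induction t with
    | zero =>
      intro _
      by_contra! hu
      refine hno 1 le_rfl hn (ser r a α 0 - ser r a α 1) 0 ?_ le_rfl ?_ hu
        (by positivity) ?_ (Or.inl ⟨1, le_rfl, hn, rfl, rfl, rfl⟩)
      · have := hi 0 (by omega); simp only [zero_add] at this; omega
      · have := hi 0 (by omega); simp only [zero_add] at this; omega
      · simp [ser]
    | succ t ih =>
      intro ht
      have hα2 := hα (t + 1) (by omega) ht
      have := hstep t ht (α (t + 1) - 1) (by omega) le_rfl (ih (by omega))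
      rw [Nat.cast_sub (by omega)] at this
      rw [show ser r a α (t + 1 + 1) = α (t + 1) * ser r a α (t + 1) - ser r a α t from rfl]
      push_cast at this
      linarith
  obtain ⟨k, rfl⟩ : ∃ k, n = k + 1 := ⟨n - 1, by omega⟩
  have hα2 := hα (k + 1) (by omega) le_rfl
  have hv := box k le_rfl _
    (hstep k le_rfl (α (k + 1) - 1) (by omega) le_rfl (hcorner k (by omega)))
  rw [Nat.cast_sub (by omega)] at hv
  have hrec : ser 0 1 α (k + 1 + 1) = α (k + 1) * ser 0 1 α (k + 1) - ser 0 1 α k := rfl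
  have hlt := (hj (k + 1) le_rfl).2
  push_cast at hv
  refine hno (k + 1) (by omega) le_rfl 0 (r - ser 0 1 α (k + 1)) le_rfl (by omega) (by omega)
    (by positivity) (by linarith) ?_ (Or.inr <| Or.inr <| Or.inr <| Or.inl ⟨rfl, rfl, rfl⟩)
  have := dvd_add (hdvd (k + 1)) (dvd_mul_left (r : ℤ) a)
  exact this.trans (dvd_of_eq (by ring))

/-- every map `S_0 -> S_{i_p}` can be seen in the diagram of special
Cohen-Macaulay modules. -/
theorem stmt_7 (r a n : ℕ) (α : ℕ → ℕ)
    (ha : 1 ≤ a) (har : a < r) (hcop : Nat.Coprime r a) (hn : 1 ≤ n)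
    (hα : ∀ t, 1 ≤ t → t ≤ n → 2 ≤ α t)
    (hval : hj ((List.range n).map fun t => (α (t + 1) : ℚ)) = (r : ℚ) / (a : ℚ)) :
    ∀ p, p ≤ n → ∀ z₁ z₂ : ℕ,
      ((z₁ : ℤ) + (a : ℤ) * (z₂ : ℤ)) ≡ ser r a α p [ZMOD (r : ℤ)] →
      HasPath r a n α 0 p z₁ z₂ := by
  have hr : (r : ℤ) ≠ 0 := by omega
  have haq : (a : ℚ) ≠ 0 := by exact_mod_cast (by omega : a ≠ 0)
  obtain ⟨hi, hi0⟩ := ser_decreasing α n hn hα r a (by omega)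
    (by rw [hval]; push_cast; field_simp)
  have hinn : ∀ t, t ≤ n + 1 → 0 ≤ ser r a α t := fun t ht => by
    induction ht using Nat.decreasingInduction with
    | self => exact hi0.ge
    | of_succ k hk ih => exact ih.trans (hi k (by omega)).le
  have hipos : ∀ t, t ≤ n → 0 < ser r a α t := fun t ht =>
    (hinn (t + 1) (by omega)).trans_lt (hi t ht)
  have hin : ser r a α n = 1 := by
    have := ser_isCoprime r a α (Nat.isCoprime_iff_coprime.2 hcop) n
    rw [hi0, isCoprime_zero_right] at this
    rcases Int.isUnit_iff.1 this with h | h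
    · exact h
    · have := hipos n le_rfl
      omega
  have hjn : ser 0 1 α (n + 1) = r := by
    have := ser_det r a α n
    rwa [hi0, hin, one_mul, zero_mul, sub_zero] at this
  have hj := ser_zero_one_increasing α n hα
  have hdvd := ser_dvd r a α
  suffices H : ∀ N : ℕ, ∀ p, p ≤ n → ∀ z₁ z₂ : ℕ, z₁ + z₂ = N →
      (r : ℤ) ∣ z₁ + a * z₂ - ser r a α p → HasPath r a n α 0 p z₁ z₂ from
    fun p hp z₁ z₂ h => H _ p hp z₁ z₂ rfl h.symm.dvd
  intro N
  induction N using Nat.strong_induction_on with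
  | _ N ih =>
  intro p hp z₁ z₂ hN h
  have extend : ∀ v, v ≤ n → ∀ x y : ℤ, 0 ≤ x → 0 ≤ y → 0 < x + y → x ≤ z₁ → y ≤ z₂ →
      (r : ℤ) ∣ x + a * y + ser r a α v - ser r a α p →
      Arrow r a n α v p (x.toNat, y.toNat) → HasPath r a n α 0 p z₁ z₂ := by
    intro v hv x y hx hy hxy hxz hyz hd harr
    lift x to ℕ using hx
    lift y to ℕ using hy
    simp only [Int.toNat_natCast] at harr
    have hx' : x ≤ z₁ := by exact_mod_cast hxz
    have hy' : y ≤ z₂ := by exact_mod_cast hyz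
    refine HasPath.snoc harr hx' hy' (ih _ ?_ v hv _ _ rfl ?_)
    · simp only
      omega
    · have := dvd_sub h hd
      simp only [Nat.cast_sub hx', Nat.cast_sub hy']
      exact this.trans (dvd_of_eq (by ring))
  cases p with
  | zero =>
    have h' : (r : ℤ) ∣ z₁ + a * z₂ := by
      have := dvd_add h (dvd_refl (r : ℤ))
      simpa [ser] using this
    by_cases hz : z₁ ≠ 0 ∨ z₂ ≠ 0
    · obtain ⟨t, -, ht, u, v, hu, hv, huv, huz, hvz, hd, harr⟩ :=
        exists_arrow_to_zero r a n α hn hr hα hi hipos hjn z₁ z₂ hz h'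
      exact extend t ht u v hu hv huv huz hvz (dvd_sub hd (dvd_refl _)) harr
    · push Not at hz
      rw [hz.1, hz.2]
      exact Relation.ReflTransGen.refl
  | succ p =>
    have hjp := hj p (by omega)
    rcases le_or_le_of_weight hr (ser_det r a α p) (hdvd p) (hdvd (p + 1)) (hipos _ hp)
      (hi p (by omega)) hjp.2 hjp.1 h (by positivity) (by positivity) with hx | hy
    · rcases hp.eq_or_lt with rfl | hlt
      · refine extend 0 (by omega) 1 0 (by omega) le_rfl (by omega) (by omega) (by omega) ?_
          (Or.inr <| Or.inl ⟨rfl, rfl, rfl⟩)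
        rw [hin]
        simp [ser]
      · have h1 := hi (p + 1) hp
        have h2 := hinn (p + 1 + 1) (by omega)
        refine extend (p + 1 + 1) hlt (ser r a α (p + 1) - ser r a α (p + 1 + 1)) 0 (by omega)
          le_rfl (by omega) (by omega) (by omega) ?_
          (Or.inl ⟨p + 1 + 1, by omega, hlt, rfl, rfl, rfl⟩)
        simp
    · refine extend p (by omega) 0 (ser 0 1 α (p + 1) - ser 0 1 α p) le_rfl (by omega)
        (by omega) (by omega) (by omega) ?_
        (Or.inr <| Or.inr <| Or.inl ⟨p, hp, rfl, rfl, rfl⟩)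
      have := dvd_sub (hdvd p) (hdvd (p + 1))
      exact this.trans (dvd_of_eq (by ring))
end
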